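/- arXiv:2209.14666 — 2 statements merged into one kernel-verified Lean document; each statement's English description precedes it below -/
import Mathlib

section
/- Let T > 0, let m : ℝ₊ → (0,∞) be a nonincreasing locally absolutely continuous function with ∫₀^∞ (1+a)³ m(a) da < ∞, let ζ : ℝ₊ × [0,T] → ℝ be measurable with −m′(a)/m(a) ≤ ζ(a,t) ≤ ζ_max a.e., and let β satisfy 0 < β_min ≤ β(t) ≤ β_max. Let g : ℝ₊ × [0,T] → ℝ be measurable with |g(a,t)| ≤ c_{0,1} (1+a) m(a), and suppose ρ₁ satisfies ρ₁(a,t) = ρ₁(0,t) exp( −∫₀^a ζ(ã,t) dã ) − ∫₀^a exp( −∫_τ^a ζ(ã,t) dã ) g(τ,t) dτ with boundary condition ρ₁(0,t) = −β(t) ∫₀^∞ ρ₁(a,t) da. Then there exists a constant c₁ > 0 such that |ρ₁(a,t)| ≤ c₁ (1+a)² m(a) for all (a,t) ∈ ℝ₊ × [0,T]. -/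
open MeasureTheory Real Set Filter


theorem aux_zint (ζ : ℝ → ℝ) (hmeas : Measurable ζ) (ζmax : ℝ)
    (h : ∀ᵐ a ∂(volume.restrict (Set.Ioi (0:ℝ))), 0 ≤ ζ a ∧ ζ a ≤ ζmax)
    (x y : ℝ) (hx : 0 ≤ x) (hxy : x ≤ y) : IntervalIntegrable ζ volume x y := by
  rw [intervalIntegrable_iff_integrableOn_Ioc_of_le hxy]
  have hsub : Set.Ioc x y ⊆ Set.Ioi 0 := fun z hz => lt_of_le_of_lt hx hz.1
  refine Measure.integrableOn_of_bounded (M := ζmax) (by simp) hmeas.aestronglyMeasurable ?_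
  filter_upwards [ae_restrict_of_ae_restrict_of_subset hsub h] with z hz
  rw [Real.norm_eq_abs, abs_of_nonneg hz.1]; exact hz.2

theorem aux_znonneg (ζ : ℝ → ℝ)
    (h : ∀ᵐ a ∂(volume.restrict (Set.Ioi (0:ℝ))), 0 ≤ ζ a)
    (x y : ℝ) (hx : 0 ≤ x) (hxy : x ≤ y) : 0 ≤ ∫ s in x..y, ζ s := by
  rw [intervalIntegral.integral_of_le hxy]
  have hsub : Set.Ioc x y ⊆ Set.Ioi 0 := fun z hz => lt_of_le_of_lt hx hz.1
  exact integral_nonneg_of_ae (ae_restrict_of_ae_restrict_of_subset hsub h)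

theorem aux_exp (m : ℝ → ℝ) (hmpos : ∀ a, 0 ≤ a → 0 < m a)
    (hmanti : AntitoneOn m (Set.Ici 0))
    (hmdiff : DifferentiableOn ℝ m (Set.Ioi 0)) (ζ : ℝ → ℝ)
    (h : ∀ᵐ a ∂(volume.restrict (Set.Ioi (0:ℝ))), -(deriv m a) / m a ≤ ζ a)
    (x y : ℝ) (hx : 0 < x) (hxy : x ≤ y) (hint : IntervalIntegrable ζ volume x y) :
    Real.exp (-∫ s in x..y, ζ s) ≤ m y / m x := by
  have hd : ∀ z, 0 < z → HasDerivAt (fun a => -Real.log (m a)) (-(deriv m z) / m z) z := by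
    intro z hz
    have h1 := ((hmdiff z hz).differentiableAt (Ioi_mem_nhds hz)).hasDerivAt
    have h2 := (h1.log (hmpos z hz.le).ne').neg
    rw [← neg_div] at h2
    exact h2
  have hmono : MonotoneOn (fun a => -Real.log (m a)) (Set.uIcc x y) := by
    rw [Set.uIcc_of_le hxy]
    intro u hu v hv huv
    have hu0 : 0 ≤ u := hx.le.trans hu.1
    have hv0 : 0 ≤ v := hx.le.trans hv.1
    exact neg_le_neg (Real.log_le_log (hmpos v hv0) (hmanti hu0 hv0 huv))
  have hi := hmono.intervalIntegrable_deriv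
  have hi2 : IntervalIntegrable (fun z => -(deriv m z) / m z) volume x y := by
    refine hi.congr ?_
    intro z hz
    rw [Set.uIoc_of_le hxy] at hz
    exact (hd z (hx.trans hz.1)).deriv
  have hF := intervalIntegral.integral_eq_sub_of_hasDerivAt (fun z hz => by
    rw [Set.uIcc_of_le hxy] at hz
    exact hd z (hx.trans_le hz.1)) hi2
  have hle : (∫ z in x..y, -(deriv m z) / m z) ≤ ∫ z in x..y, ζ z := by
    refine intervalIntegral.integral_mono_ae_restrict hxy hi2 hint ?_
    exact ae_restrict_of_ae_restrict_of_subset (fun z hz => lt_of_lt_of_le hx hz.1) h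
  have hpx := hmpos x hx.le
  have hpy := hmpos y (hx.le.trans hxy)
  rw [← Real.exp_log (div_pos hpy hpx), Real.log_div hpy.ne' hpx.ne']
  apply Real.exp_le_exp.2
  linarith

/-- Bound `|ρ₁(a,t)| ≤ c₁ (1+a)² m(a)` for the first-order macroscopic corrector of the
linkage density (Proposition 4.2 of the paper, case `j = 1`), where the source
`g = ∂_t ρ₀` satisfies `|g(a,t)| ≤ c_{0,1}(1+a) m(a)`. -/
theorem stmt12 (T : ℝ) (hT : 0 < T)
    (m : ℝ → ℝ) (hmpos : ∀ a, 0 ≤ a → 0 < m a) (hmanti : AntitoneOn m (Set.Ici 0))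
    (hmdiff : DifferentiableOn ℝ m (Set.Ioi 0))
    (hmint : IntegrableOn (fun a => (1 + a) ^ 3 * m a) (Set.Ioi 0))
    (ζ : ℝ → ℝ → ℝ) (hζmeas : Measurable (Function.uncurry ζ)) (ζmax : ℝ)
    (hζ : ∀ t ∈ Set.Icc (0:ℝ) T, ∀ᵐ a ∂(volume.restrict (Set.Ioi (0:ℝ))),
      -(deriv m a) / m a ≤ ζ a t ∧ ζ a t ≤ ζmax)
    (β : ℝ → ℝ) (βmin βmax : ℝ) (hβmin : 0 < βmin)
    (hβ : ∀ t ∈ Set.Icc (0:ℝ) T, βmin ≤ β t ∧ β t ≤ βmax)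
    (g : ℝ → ℝ → ℝ) (hgmeas : Measurable (Function.uncurry g)) (c01 : ℝ)
    (hg : ∀ a, 0 ≤ a → ∀ t ∈ Set.Icc (0:ℝ) T, |g a t| ≤ c01 * (1 + a) * m a)
    (ρ₁ : ℝ → ℝ → ℝ)
    (hρform : ∀ a, 0 ≤ a → ∀ t ∈ Set.Icc (0:ℝ) T,
      ρ₁ a t = ρ₁ 0 t * Real.exp (-∫ s in (0:ℝ)..a, ζ s t)
        - ∫ τ in (0:ℝ)..a, Real.exp (-∫ s in τ..a, ζ s t) * g τ t)
    (hρbc : ∀ t ∈ Set.Icc (0:ℝ) T,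
      ρ₁ 0 t = -(β t) * ∫ a in Set.Ioi (0:ℝ), ρ₁ a t) :
    ∃ c₁ : ℝ, 0 < c₁ ∧ ∀ a, 0 ≤ a → ∀ t ∈ Set.Icc (0:ℝ) T,
      |ρ₁ a t| ≤ c₁ * (1 + a) ^ 2 * m a := by
  have h0T : (0:ℝ) ∈ Set.Icc (0:ℝ) T := ⟨le_rfl, hT.le⟩
  have hc01 : 0 ≤ c01 := by
    have h := (abs_nonneg _).trans (hg 0 le_rfl 0 h0T)
    have := hmpos 0 le_rfl
    simp only [add_zero, mul_one] at h
    exact nonneg_of_mul_nonneg_left h this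
  have hβmax : 0 ≤ βmax := by
    have := hβ 0 h0T
    linarith
  have hm1 := hmpos 1 zero_le_one
  have hI0 : 0 ≤ ∫ a in Set.Ioi (0:ℝ), (1 + a) ^ 3 * m a := by
    refine setIntegral_nonneg measurableSet_Ioi fun a ha => ?_
    have ha : (0:ℝ) < a := ha
    have := hmpos a ha.le
    positivity
  set I := ∫ a in Set.Ioi (0:ℝ), (1 + a) ^ 3 * m a with hI
  have hdm : ∀ a, 0 < a → 0 ≤ -(deriv m a) / m a := by
    intro a ha
    have h1 : derivWithin m (Set.Ici 0) a ≤ 0 := hmanti.derivWithin_nonpos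
    rw [derivWithin_of_mem_nhds (Ici_mem_nhds ha)] at h1
    exact div_nonneg (by linarith) (hmpos a ha.le).le
  refine ⟨βmax * (c01 * I) / m 1 + c01 + 1, by positivity, ?_⟩
  intro a ha t ht
  have hz1 : ∀ᵐ a ∂(volume.restrict (Set.Ioi (0:ℝ))), 0 ≤ ζ a t ∧ ζ a t ≤ ζmax := by
    filter_upwards [hζ t ht, ae_restrict_mem measurableSet_Ioi] with z hz hz0
    exact ⟨(hdm z hz0).trans hz.1, hz.2⟩
  have hzm : Measurable (fun s => ζ s t) := hζmeas.comp (measurable_id.prodMk measurable_const)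
  have hzi := aux_zint (fun s => ζ s t) hzm ζmax hz1
  have hzn := aux_znonneg (fun s => ζ s t) (hz1.mono fun _ h => h.1)
  have hze : ∀ x y, 0 < x → x ≤ y → Real.exp (-∫ s in x..y, ζ s t) ≤ m y / m x :=
    fun x y hx hxy => aux_exp m hmpos hmanti hmdiff (fun s => ζ s t)
      ((hζ t ht).mono fun _ h => h.1) x y hx hxy (hzi x y hx.le hxy)
  have hE : ∀ y, 0 ≤ y → Real.exp (-∫ s in (0:ℝ)..y, ζ s t) ≤ m y / m 1 := by
    intro y hy
    rcases le_total y 1 with h | h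
    · calc Real.exp (-∫ s in (0:ℝ)..y, ζ s t) ≤ 1 := by
            rw [Real.exp_le_one_iff]
            have := hzn 0 y le_rfl hy
            linarith
        _ ≤ m y / m 1 := by
            rw [le_div_iff₀ hm1, one_mul]
            exact hmanti hy (show (0:ℝ) ≤ 1 from zero_le_one) h
    · refine le_trans ?_ (hze 1 y one_pos h)
      apply Real.exp_le_exp.2
      have h1 := intervalIntegral.integral_add_adjacent_intervals
        (hzi 0 1 le_rfl zero_le_one) (hzi 1 y zero_le_one h)
      have h2 := hzn 0 1 le_rfl zero_le_one
      linarith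
  have hG : ∀ y, 0 ≤ y → |∫ τ in (0:ℝ)..y, Real.exp (-∫ s in τ..y, ζ s t) * g τ t|
      ≤ c01 * (1 + y) ^ 2 * m y := by
    intro y hy
    have hmy := hmpos y hy
    have h1 : ‖∫ τ in (0:ℝ)..y, Real.exp (-∫ s in τ..y, ζ s t) * g τ t‖
        ≤ (c01 * (1 + y) * m y) * |y - 0| := by
      refine intervalIntegral.norm_integral_le_of_norm_le_const fun τ hτ => ?_
      rw [Set.uIoc_of_le hy] at hτ
      have hmτ := hmpos τ hτ.1.le
      rw [norm_mul, Real.norm_eq_abs, Real.norm_eq_abs, abs_of_pos (Real.exp_pos _)]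
      calc _ ≤ (m y / m τ) * (c01 * (1 + τ) * m τ) :=
            mul_le_mul (hze τ y hτ.1 hτ.2) (hg τ hτ.1.le t ht) (abs_nonneg _) (by positivity)
        _ = c01 * (1 + τ) * m y := by field_simp
        _ ≤ c01 * (1 + y) * m y := by
            have := hτ.2
            gcongr
    rw [Real.norm_eq_abs, sub_zero, abs_of_nonneg hy] at h1
    refine h1.trans ?_
    have : 0 ≤ c01 * (1 + y) * m y := by positivity
    nlinarith
  have hR : |ρ₁ 0 t| ≤ βmax * (c01 * I) := by
    by_cases hint : IntegrableOn (fun a => ρ₁ a t) (Set.Ioi 0)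
    · have hEint : IntegrableOn (fun y => Real.exp (-∫ s in (0:ℝ)..y, ζ s t)) (Set.Ioi 0) := by
        refine Integrable.mono' (hmint.div_const (m 1)) ?_ ?_
        · refine (aemeasurable_restrict_of_antitoneOn measurableSet_Ioi ?_).aestronglyMeasurable
          intro u hu v hv huv
          have hu : (0:ℝ) < u := hu
          apply Real.exp_le_exp.2
          have h1 := intervalIntegral.integral_add_adjacent_intervals
            (hzi 0 u le_rfl hu.le) (hzi u v hu.le huv)
          have h2 := hzn u v hu.le huv
          linarith
        · filter_upwards [ae_restrict_mem measurableSet_Ioi] with y hy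
          have hy : (0:ℝ) < y := hy
          rw [Real.norm_eq_abs, abs_of_pos (Real.exp_pos _)]
          refine (hE y hy.le).trans ?_
          have := hmpos y hy.le
          gcongr
          have : 1 ≤ (1 + y) ^ 3 := one_le_pow₀ (by linarith)
          nlinarith
      have hEn : 0 ≤ ∫ y in Set.Ioi (0:ℝ), Real.exp (-∫ s in (0:ℝ)..y, ζ s t) :=
        integral_nonneg fun _ => (Real.exp_pos _).le
      have hsub : (∫ y in Set.Ioi (0:ℝ),
          (ρ₁ 0 t * Real.exp (-∫ s in (0:ℝ)..y, ζ s t) - ρ₁ y t))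
          = ρ₁ 0 t * (∫ y in Set.Ioi (0:ℝ), Real.exp (-∫ s in (0:ℝ)..y, ζ s t))
            - ∫ y in Set.Ioi (0:ℝ), ρ₁ y t := by
        rw [integral_sub (hEint.const_mul _) hint, integral_const_mul]
      have hGb : |∫ y in Set.Ioi (0:ℝ),
          (ρ₁ 0 t * Real.exp (-∫ s in (0:ℝ)..y, ζ s t) - ρ₁ y t)| ≤ c01 * I := by
        rw [hI, ← integral_const_mul, ← Real.norm_eq_abs]
        refine norm_integral_le_of_norm_le (hmint.const_mul c01) ?_
        filter_upwards [ae_restrict_mem measurableSet_Ioi] with y hy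
        have hy : (0:ℝ) < y := hy
        have hmy := hmpos y hy.le
        rw [hρform y hy.le t ht, sub_sub_cancel, Real.norm_eq_abs]
        refine (hG y hy.le).trans ?_
        rw [mul_assoc]
        gcongr
        · linarith
        · norm_num
      have hbc := hρbc t ht
      rw [hsub] at hGb
      set P := ∫ y in Set.Ioi (0:ℝ), ρ₁ y t
      set Q := ∫ y in Set.Ioi (0:ℝ), Real.exp (-∫ s in (0:ℝ)..y, ζ s t)
      set r := ρ₁ 0 t
      have hb := hβ t ht
      have hb0 : 0 ≤ β t := by linarith
      have key : r * (1 + β t * Q) = β t * (r * Q - P) := by linear_combination hbc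
      have hQ : 0 ≤ β t * Q := mul_nonneg hb0 hEn
      calc |r| ≤ |r| * (1 + β t * Q) := by nlinarith [abs_nonneg r]
        _ = |r * (1 + β t * Q)| := by rw [abs_mul, abs_of_nonneg (by linarith : 0 ≤ 1 + β t * Q)]
        _ = β t * |r * Q - P| := by rw [key, abs_mul, abs_of_nonneg hb0]
        _ ≤ βmax * (c01 * I) := mul_le_mul hb.2 hGb (abs_nonneg _) hβmax
    · rw [hρbc t ht, integral_undef hint]
      simp only [mul_zero, abs_zero]
      positivity
  have hma := hmpos a ha
  rw [hρform a ha t ht]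
  calc _ ≤ |ρ₁ 0 t * Real.exp (-∫ s in (0:ℝ)..a, ζ s t)|
        + |∫ τ in (0:ℝ)..a, Real.exp (-∫ s in τ..a, ζ s t) * g τ t| := abs_sub _ _
    _ ≤ βmax * (c01 * I) * (m a / m 1) + c01 * (1 + a) ^ 2 * m a := by
        rw [abs_mul, abs_of_pos (Real.exp_pos _)]
        exact add_le_add (mul_le_mul hR (hE a ha) (Real.exp_pos _).le (by positivity)) (hG a ha)
    _ = βmax * (c01 * I) / m 1 * 1 * m a + c01 * (1 + a) ^ 2 * m a := by ring
    _ ≤ βmax * (c01 * I) / m 1 * (1 + a) ^ 2 * m a + c01 * (1 + a) ^ 2 * m a := by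
        gcongr
        exact one_le_pow₀ (by linarith)
    _ ≤ (βmax * (c01 * I) / m 1 + c01 + 1) * (1 + a) ^ 2 * m a := by
        have : 0 ≤ (1 + a) ^ 2 * m a := by positivity
        linarith
end

section
/- Let k : ℝ₊ → ℝ₊ be a nonincreasing nonnegative function with k ∈ L¹(ℝ₊). Then there exists a resolvent r ∈ L¹(ℝ₊) satisfying r(t) + (r ⋆ k)(t) = k(t) for a.e. t ∈ ℝ₊. -/
open MeasureTheory Real Set Filter

noncomputable def cv (f g : ℝ → ℝ) : ℝ → ℝ := fun x => ∫ t, f t * g (x - t)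

theorem cv_eq (f g : ℝ → ℝ) : cv f g = convolution f g (ContinuousLinearMap.mul ℝ ℝ) volume := rfl

theorem cv_int {f g : ℝ → ℝ} (hf : Integrable f) (hg : Integrable g) : Integrable (cv f g) :=
  hf.integrable_convolution (ContinuousLinearMap.mul ℝ ℝ) hg

theorem cv_ex {f g : ℝ → ℝ} (hf : Integrable f) (hg : Integrable g) :
    ∀ᵐ x, Integrable (fun t => f t * g (x - t)) :=
  hf.ae_convolution_exists (ContinuousLinearMap.mul ℝ ℝ) hg

theorem cv_comm (f g : ℝ → ℝ) : cv f g = cv g f := by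
  ext x
  unfold cv
  rw [← integral_sub_left_eq_self _ volume x]
  simp [mul_comm]

theorem cv_integral {f g : ℝ → ℝ} (hf : Integrable f) (hg : Integrable g) :
    ∫ x, cv f g x = (∫ x, f x) * ∫ x, g x :=
  integral_convolution (ContinuousLinearMap.mul ℝ ℝ) hf hg

theorem cv_norm {f g : ℝ → ℝ} (hf : Integrable f) (hg : Integrable g) :
    ∫ x, |cv f g x| ≤ (∫ x, |f x|) * ∫ x, |g x| := by
  rw [← cv_integral hf.abs hg.abs]
  refine integral_mono (cv_int hf hg).abs (cv_int hf.abs hg.abs) fun x => ?_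
  refine (abs_integral_le_integral_abs).trans_eq ?_
  simp [cv, abs_mul]

theorem cv_assoc {f g k : ℝ → ℝ} (hf : Integrable f) (hg : Integrable g) (hk : Integrable k) :
    ∀ᵐ x, cv (cv f g) k x = cv f (cv g k) x := by
  have h := cv_ex hf.norm (cv_int hg.norm hk.norm)
  filter_upwards [h] with x hx
  exact convolution_assoc (ContinuousLinearMap.mul ℝ ℝ) (ContinuousLinearMap.mul ℝ ℝ)
    (ContinuousLinearMap.mul ℝ ℝ) (ContinuousLinearMap.mul ℝ ℝ) (fun x y z => mul_assoc x y z)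
    hf.1 hg.1 hk.1 (cv_ex hf hg) (cv_ex hg.norm hk.norm) hx

theorem cv_congr {f g g' : ℝ → ℝ} (h : g =ᵐ[volume] g') : cv f g = cv f g' :=
  convolution_congr (ContinuousLinearMap.mul ℝ ℝ) (ae_eq_refl f) h

theorem cv_sub {f g g' : ℝ → ℝ} (hf : Integrable f) (hg : Integrable g) (hg' : Integrable g') :
    ∀ᵐ x, cv f (fun t => g t - g' t) x = cv f g x - cv f g' x := by
  filter_upwards [cv_ex hf hg, cv_ex hf hg'] with x h1 h2
  simp only [cv]
  rw [← integral_sub h1 h2]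
  simp [mul_sub]

theorem cv_add {f g g' : ℝ → ℝ} (hf : Integrable f) (hg : Integrable g) (hg' : Integrable g') :
    ∀ᵐ x, cv f (fun t => g t + g' t) x = cv f g x + cv f g' x := by
  filter_upwards [cv_ex hf hg, cv_ex hf hg'] with x h1 h2
  simp only [cv]
  rw [← integral_add h1 h2]
  simp [mul_add]

theorem cv_smul {f g : ℝ → ℝ} (c : ℝ) : cv f (fun t => c * g t) = fun x => c * cv f g x := by
  ext x
  simp only [cv]
  rw [← integral_const_mul]
  congr 1; ext t; ring

theorem fixpt {κ h : ℝ → ℝ} (hκ : Integrable κ) (hh : Integrable h) (hn : ∫ x, |h x| < 1)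
    (hκ0 : ∀ x ≤ 0, κ x = 0) (hh0 : ∀ x ≤ 0, h x = 0) :
    ∃ y : ℝ → ℝ, Integrable y ∧ (∀ x ≤ 0, y x = 0) ∧ ∀ᵐ x, y x = κ x + cv h y x := by
  let P : (ℝ → ℝ) → ℝ → ℝ := fun y => indicator (Ioi 0) y
  have hP : ∀ y : ℝ → ℝ, Integrable y → Integrable (P y) := fun y hy => hy.indicator measurableSet_Ioi
  have hI : ∀ y : Lp ℝ 1 (volume : Measure ℝ), Integrable (fun x => κ x + cv h (P y) x) :=
    fun y => hκ.add (cv_int hh (hP y (L1.integrable_coeFn y)))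
  let T : Lp ℝ 1 (volume : Measure ℝ) → Lp ℝ 1 (volume : Measure ℝ) := fun y => (hI y).toL1 _
  have hq0 : 0 ≤ ∫ x, |h x| := integral_nonneg fun x => abs_nonneg _
  have hT : ContractingWith ⟨∫ x, |h x|, hq0⟩ T := by
    refine ⟨by exact_mod_cast hn, LipschitzWith.of_dist_le_mul fun y z => ?_⟩
    have hy := L1.integrable_coeFn y
    have hz := L1.integrable_coeFn z
    rw [dist_eq_norm, dist_eq_norm]
    simp only [T]
    rw [← Integrable.toL1_sub, L1.norm_of_fun_eq_integral_norm, L1.norm_eq_integral_norm]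
    have h1 : ∀ᵐ x, ‖((fun x => κ x + cv h (P y) x) - fun x => κ x + cv h (P z) x) x‖
        = |cv h (fun t => P y t - P z t) x| := by
      filter_upwards [cv_sub hh (hP y hy) (hP z hz)] with x hx
      simp [hx]
    rw [integral_congr_ae h1]
    refine (cv_norm hh ((hP y hy).sub (hP z hz))).trans ?_
    refine mul_le_mul_of_nonneg_left ?_ hq0
    refine integral_mono_ae ((hP y hy).sub (hP z hz)).abs (L1.integrable_coeFn _).norm ?_
    filter_upwards [Lp.coeFn_sub y z] with x hx
    rw [hx]
    simp only [P, indicator, Pi.sub_apply, Real.norm_eq_abs]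
    split_ifs <;> simp
  have hfix := hT.fixedPoint_isFixedPt
  set y := hT.fixedPoint T
  have hy := L1.integrable_coeFn y
  have hye : ∀ᵐ x, y x = κ x + cv h (P y) x := by
    have := (hI y).coeFn_toL1
    have h2 : (hI y).toL1 _ = y := hfix
    rw [h2] at this
    exact this
  refine ⟨P y, hP y hy, fun x hx => indicator_of_notMem (by simpa using hx) _, ?_⟩
  filter_upwards [hye] with x hx
  by_cases h0 : 0 < x
  · rw [← hx]; simp [P, h0]
  · push Not at h0
    have : cv h (P y) x = 0 := by
      unfold cv
      rw [integral_eq_zero_of_ae]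
      filter_upwards with t
      by_cases ht : t ≤ 0
      · simp [hh0 t ht]
      · have : x - t ≤ 0 := by linarith
        have h3 : P y (x - t) = 0 := indicator_of_notMem (by simpa using this) _
        simp [h3]
    rw [this, hκ0 x h0]
    simp [P, h0]

theorem algebra_step {κ E : ℝ → ℝ} {c : ℝ} (hκ : Integrable κ) (hE : Integrable E)
    (hκ0 : ∀ x ≤ 0, κ x = 0) (hE0 : ∀ x ≤ 0, E x = 0)
    (hn : ∫ x, |c * (E x + cv κ E x) - κ x| < 1) :
    ∃ r : ℝ → ℝ, Integrable r ∧ (∀ x ≤ 0, r x = 0) ∧ ∀ᵐ x, r x + cv κ r x = κ x := by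
  have hz : ∀ f g : ℝ → ℝ, (∀ x ≤ 0, f x = 0) → (∀ x ≤ 0, g x = 0) → ∀ x ≤ 0, cv f g x = 0 := by
    intro f g hf hg x hx
    unfold cv
    rw [integral_eq_zero_of_ae]
    filter_upwards with t
    by_cases ht : t ≤ 0
    · simp [hf t ht]
    · simp [hg (x - t) (by linarith)]
  have hκE := cv_int hκ hE
  obtain ⟨y, hy, hy0, hye⟩ := fixpt (h := fun x => c * (E x + cv κ E x) - κ x) hκ
    (((hE.add hκE).const_mul c).sub hκ) hn hκ0
    (fun x hx => by simp [hE0 x hx, hκ0 x hx, hz κ E hκ0 hE0 x hx])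
  have hEy := cv_int hE hy
  refine ⟨fun x => y x - c * cv E y x, hy.sub (hEy.const_mul c), fun x hx => by
    simp [hy0 x hx, hz E y hE0 hy0 x hx], ?_⟩
  have e1 := cv_sub hκ hy (hEy.const_mul c)
  have e2 := cv_assoc hκ hE hy
  have e3 := cv_sub hy ((hE.add hκE).const_mul c) hκ
  have e4 := cv_add hy hE hκE
  filter_upwards [hye, e1, e2, e3, e4] with x h0 h1 h2 h3 h4
  rw [cv_comm] at h0
  simp only [Pi.add_apply] at h3
  rw [h3] at h0
  simp only [cv_smul] at h0 h1
  rw [h1, ← h2, h0, h4, cv_comm y E, cv_comm y κ, cv_comm y (cv κ E)]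
  have := h0
  rw [h4, cv_comm y E, cv_comm y κ, cv_comm y (cv κ E)] at this
  linarith

theorem small_step {f F : ℝ → ℝ} (hf : Integrable f) (hF : Integrable F)
    (hf1 : ∫ x, f x = 1) (hFp : 0 < ∫ x, F x) (hF0 : ∀ x, 0 ≤ F x) (hf0 : ∀ x, 0 ≤ f x)
    (hfF : ∀ x, F x = 0 ∨ 0 < f x) :
    ∃ ε : ℝ, ∫ x, |f x - ε * F x| < 1 := by
  have hm : ∀ n : ℕ, Integrable (fun x => max (F x - (n + 1 : ℝ) * f x) 0) := fun n =>
    (hF.sub (hf.const_mul _)).pos_part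
  have hlim : Tendsto (fun n : ℕ => ∫ x, max (F x - (n + 1 : ℝ) * f x) 0) atTop
      (nhds (∫ x : ℝ, (0 : ℝ))) := by
    refine tendsto_integral_of_dominated_convergence F (fun n => (hm n).1) hF ?_ ?_
    · intro n
      filter_upwards with x
      rw [Real.norm_of_nonneg (le_max_right _ _)]
      refine max_le ?_ (hF0 x)
      have : 0 ≤ (n + 1 : ℝ) * f x := mul_nonneg (by positivity) (hf0 x)
      linarith
    · filter_upwards with x
      rcases hfF x with h | h
      · refine tendsto_const_nhds.congr fun n => ?_
        have : 0 ≤ (n + 1 : ℝ) * f x := mul_nonneg (by positivity) (hf0 x)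
        rw [h, max_eq_right]
        linarith
      · obtain ⟨N, hN⟩ := exists_nat_gt (F x / f x)
        refine tendsto_const_nhds.congr' ?_
        filter_upwards [eventually_ge_atTop N] with n hn
        rw [max_eq_right]
        rw [div_lt_iff₀ h] at hN
        have : (N : ℝ) ≤ n + 1 := by
          have : (N : ℝ) ≤ n := by exact_mod_cast hn
          linarith
        nlinarith
  rw [integral_zero] at hlim
  obtain ⟨n, hn⟩ := (hlim.eventually (gt_mem_nhds (half_pos hFp))).exists
  have hn0 : (0 : ℝ) < n + 1 := by positivity
  refine ⟨1 / (n + 1 : ℝ), ?_⟩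
  have key : ∀ x, |f x - 1 / (n + 1 : ℝ) * F x| = f x - 1 / (n + 1 : ℝ) * F x +
      2 / (n + 1 : ℝ) * max (F x - (n + 1 : ℝ) * f x) 0 := by
    intro x
    have e : f x - 1 / (n + 1 : ℝ) * F x = -(1 / (n + 1 : ℝ)) * (F x - (n + 1 : ℝ) * f x) := by
      field_simp
      ring
    rw [e]
    have e2 : (0 : ℝ) < 1 / (n + 1 : ℝ) := by positivity
    rw [abs_mul, abs_neg, abs_of_pos e2]
    rcases le_total (F x - (n + 1 : ℝ) * f x) 0 with h | h
    · rw [max_eq_right h, abs_of_nonpos h]; ring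
    · rw [max_eq_left h, abs_of_nonneg h]; ring
  simp_rw [key]
  have hs : Integrable (fun x => f x - 1 / (n + 1 : ℝ) * F x) := hf.sub (hF.const_mul _)
  rw [integral_add hs ((hm n).const_mul _),
    integral_sub hf (hF.const_mul _), integral_const_mul, integral_const_mul, hf1]
  have e2 : (0 : ℝ) < 1 / (n + 1 : ℝ) := by positivity
  have e3 : (2 : ℝ) / (n + 1 : ℝ) = 2 * (1 / (n + 1 : ℝ)) := by ring
  rw [e3]
  nlinarith

theorem stmt13 (k : ℝ → ℝ) (hnn : ∀ a, 0 ≤ a → 0 ≤ k a)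
    (hanti : AntitoneOn k (Set.Ici 0))
    (hint : IntegrableOn k (Set.Ioi 0)) :
    ∃ r : ℝ → ℝ, IntegrableOn r (Set.Ioi 0) ∧
      ∀ᵐ t ∂(volume.restrict (Set.Ioi (0:ℝ))),
        r t + (∫ τ in (0:ℝ)..t, r (t - τ) * k τ) = k t := by
  obtain ⟨K, hKdef⟩ : ∃ K, K = k 0 + 1 := ⟨_, rfl⟩
  have hk0 := hnn 0 le_rfl
  have hK : 0 < K := by linarith
  let κ : ℝ → ℝ := indicator (Ioi 0) k
  let E : ℝ → ℝ := indicator (Ioi 0) (fun x => exp (-K * x))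
  have hκ : Integrable κ := hint.integrable_indicator measurableSet_Ioi
  have hE : Integrable E := (integrableOn_exp_mul_Ioi (neg_lt_zero.2 hK) 0).integrable_indicator measurableSet_Ioi
  have hκ0 : ∀ x ≤ 0, κ x = 0 := fun x hx => indicator_of_notMem (by simpa using hx) _
  have hE0 : ∀ x ≤ 0, E x = 0 := fun x hx => indicator_of_notMem (by simpa using hx) _
  have hκp : ∀ x, 0 < x → κ x = k x := fun x hx => indicator_of_mem (by simpa using hx) _
  have hEp : ∀ x, 0 < x → E x = exp (-K * x) := fun x hx => indicator_of_mem (by simpa using hx) _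
  have hκnn : ∀ x, 0 ≤ κ x := fun x => indicator_nonneg (fun x hx => hnn x (le_of_lt hx)) x
  have hEnn : ∀ x, 0 ≤ E x := fun x => indicator_nonneg (fun x hx => (exp_pos _).le) x
  have hEle : ∀ x, E x ≤ 1 := by
    intro x
    rcases le_or_gt x 0 with h | h
    · rw [hE0 x h]; norm_num
    · rw [hEp x h, exp_le_one_iff]; nlinarith
  have hEm : Measurable E := (by fun_prop : Measurable (fun x => exp (-K * x))).indicator measurableSet_Ioi
  have hEi : ∫ x, E x = 1 / K := by
    rw [integral_indicator measurableSet_Ioi, integral_exp_mul_Ioi (neg_lt_zero.2 hK)]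
    simp
  have hκi : 0 ≤ ∫ x, κ x := integral_nonneg hκnn
  have hcnn : ∀ x, 0 ≤ cv κ E x := fun x => integral_nonneg fun t => mul_nonneg (hκnn _) (hEnn _)
  have hlow : ∀ x, 0 < x → k x * (1 - exp (-K * x)) / K ≤ cv κ E x := by
    intro x hx
    have hG : ∫ t in Ioo 0 x, k x * exp (-K * (x - t)) = k x * (1 - exp (-K * x)) / K := by
      rw [← integral_Ioc_eq_integral_Ioo, ← intervalIntegral.integral_of_le hx.le]
      have hd : ∀ t ∈ uIcc 0 x, HasDerivAt (fun t => k x * exp (-K * (x - t)) / K)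
          (k x * exp (-K * (x - t))) t := by
        intro t _
        have h1 : HasDerivAt (fun t => -K * (x - t)) K t := by
          have := ((hasDerivAt_id t).const_sub x).const_mul (-K)
          simpa using this
        have := (h1.exp.const_mul (k x)).div_const K
        rw [← mul_assoc, mul_div_assoc, div_self hK.ne', mul_one] at this
        exact this
      rw [intervalIntegral.integral_eq_sub_of_hasDerivAt hd
        (Continuous.intervalIntegrable (by fun_prop) _ _)]
      simp
      ring
    rw [← hG, ← integral_indicator measurableSet_Ioo]
    refine integral_mono ?_ ?_ ?_
    · exact ((Continuous.integrableOn_Ioc (by fun_prop)).mono_set Ioo_subset_Ioc_self).integrable_indicator measurableSet_Ioo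
    · refine hκ.mul_bdd (c := 1) (hEm.comp (by fun_prop)).aestronglyMeasurable ?_
      filter_upwards with t
      rw [Real.norm_of_nonneg (hEnn _)]
      exact hEle _
    · intro t
      by_cases ht : t ∈ Ioo 0 x
      · rw [indicator_of_mem ht]
        simp only
        rw [hκp t ht.1, hEp (x - t) (by linarith [ht.2])]
        exact mul_le_mul_of_nonneg_right (hanti ht.1.le hx.le ht.2.le) (exp_pos _).le
      · rw [indicator_of_notMem ht]
        exact mul_nonneg (hκnn _) (hEnn _)
  have hκE := cv_int hκ hE
  let F : ℝ → ℝ := fun x => E x + cv κ E x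
  let f : ℝ → ℝ := fun x => K * F x - κ x
  have hF : Integrable F := hE.add hκE
  have hf : Integrable f := (hF.const_mul K).sub hκ
  have hFi : ∫ x, F x = (1 + ∫ x, κ x) / K := by
    simp only [F]
    rw [integral_add hE hκE, cv_integral hκ hE, hEi]
    ring
  have hfi : ∫ x, f x = 1 := by
    simp only [f]
    rw [integral_sub (hF.const_mul K) hκ, integral_const_mul, hFi]
    field_simp
    ring
  have hFz : ∀ x ≤ 0, F x = 0 := by
    intro x hx
    have : cv κ E x = 0 := by
      unfold cv
      rw [integral_eq_zero_of_ae]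
      filter_upwards with t
      by_cases ht : t ≤ 0
      · simp [hκ0 t ht]
      · simp [hE0 (x - t) (by linarith)]
    simp [F, hE0 x hx, this]
  have hfp : ∀ x, 0 < x → 0 < f x := by
    intro x hx
    have h1 := hlow x hx
    rw [div_le_iff₀ hK] at h1
    simp only [f, F]
    rw [hEp x hx, hκp x hx]
    have h2 : k x ≤ k 0 := hanti (by simp) hx.le hx.le
    have h3 := exp_pos (-K * x)
    nlinarith
  obtain ⟨ε, hε⟩ := small_step hf hF hfi (by rw [hFi]; positivity)
    (fun x => add_nonneg (hEnn x) (hcnn x))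
    (fun x => by
      rcases le_or_gt x 0 with h | h
      · simp [f, hFz x h, hκ0 x h]
      · exact (hfp x h).le)
    (fun x => by
      rcases le_or_gt x 0 with h | h
      · exact Or.inl (hFz x h)
      · exact Or.inr (hfp x h))
  obtain ⟨r, hr, hr0, hre⟩ := algebra_step (c := K - ε) hκ hE hκ0 hE0 (by
    convert hε using 4
    simp only [f, F]; ring)
  refine ⟨r, hr.integrableOn, ?_⟩
  rw [ae_restrict_iff' measurableSet_Ioi]
  filter_upwards [hre] with t ht h0
  rw [mem_Ioi] at h0
  rw [← hκp t h0, ← ht]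
  congr 1
  rw [intervalIntegral.integral_of_le h0.le, ← integral_indicator measurableSet_Ioc]
  unfold cv
  congr 1
  ext s
  by_cases hs : s ∈ Ioc 0 t
  · rw [indicator_of_mem hs, hκp s hs.1, mul_comm]
  · rw [indicator_of_notMem hs]
    by_cases hs0 : s ≤ 0
    · simp [hκ0 s hs0]
    · have : t ≤ s := by
        by_contra hh
        exact hs ⟨by linarith, by linarith⟩
      simp [hr0 (t - s) (by linarith)]
end
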